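/- arXiv:1908.09350 — 6 statements merged into one kernel-verified Lean document; each statement's English description precedes it below -/
import Mathlib

section
/- For each integer i, there exists a strictly positive element τ ∈ ker L_i, i.e., an i-chain τ with L_i τ = 0 and τ(f) > 0 for every i-face f of Δ. -/
open Finset Matrix

/-- A finite abstract simplicial complex on the vertex set `Fin n`: a collection of
finite subsets of `Fin n` (its faces) closed under taking subsets. -/
structure SComplex (n : ℕ) where
  faces : Finset (Finset (Fin n))
  down_closed : ∀ s ∈ faces, ∀ t ⊆ s, t ∈ faces

namespace SComplex

variable {n : ℕ} (Δ : SComplex n)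

/-- The faces of cardinality `k`, i.e. the `(k-1)`-dimensional faces. -/
def Faces (k : ℕ) : Finset (Finset (Fin n)) :=
  Δ.faces.filter fun f => f.card = k

/-- The group of `(k-1)`-dimensional chains: formal `ℤ`-linear combinations of the
faces of cardinality `k`.  (So `Chain 0` plays the role of `C_{-1}(Δ) ≅ ℤ`, generated
by the empty face, and `Chain (i+1)` is the group `C_i(Δ)` of `i`-dimensional chains.) -/
abbrev Chain (k : ℕ) : Type := {f // f ∈ Δ.Faces k} → ℤ

/-- The sign `(-1)^j` with which the subface `g` (obtained from `f` by deleting its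
`j`-th smallest vertex) occurs in the boundary of `f`; `0` if `g` is not a
codimension-one subface of `f`. -/
def bcoef (f g : Finset (Fin n)) : ℤ :=
  if g ⊆ f ∧ f.card = g.card + 1 then
    ∑ v ∈ f \ g, (-1 : ℤ) ^ (f.filter (fun x => x < v)).card
  else 0

/-- The matrix (in the standard bases, with the standard orientation) of the boundary
map from chains on faces of cardinality `k+1` to chains on faces of cardinality `k`. -/
def B (k : ℕ) : Matrix {f // f ∈ Δ.Faces k} {f // f ∈ Δ.Faces (k + 1)} ℤ :=
  fun g f => bcoef (f : Finset (Fin n)) (g : Finset (Fin n))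

/-- The simplicial boundary map `∂_k : C_k(Δ) → C_{k-1}(Δ)` (standard orientation),
as a map `Chain (k+1) → Chain k`.  For `k = 0` this is the reduced boundary map into
`C_{-1}(Δ) ≅ ℤ`. -/
noncomputable def bdry (k : ℕ) : Δ.Chain (k + 1) →ₗ[ℤ] Δ.Chain k :=
  (Δ.B k).mulVecLin

/-- The transpose `∂_kᵗ` of the boundary map. -/
noncomputable def tbdry (k : ℕ) : Δ.Chain k →ₗ[ℤ] Δ.Chain (k + 1) :=
  ((Δ.B k)ᵀ).mulVecLin

/-- The matrix of the `i`-th (up-down combinatorial) Laplacian. -/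
def LapM (i : ℕ) : Matrix {f // f ∈ Δ.Faces (i + 1)} {f // f ∈ Δ.Faces (i + 1)} ℤ :=
  Δ.B (i + 1) * (Δ.B (i + 1))ᵀ

/-- The `i`-th Laplacian `L_i = ∂_{i+1} ∘ ∂_{i+1}ᵗ` on `i`-dimensional chains. -/
noncomputable def Lap (i : ℕ) : Δ.Chain (i + 1) →ₗ[ℤ] Δ.Chain (i + 1) :=
  (Δ.LapM i).mulVecLin

/-- A chain is effective if all of its coefficients are nonnegative. -/
def Effective {k : ℕ} (σ : Δ.Chain k) : Prop := ∀ f, 0 ≤ σ f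

/-- `σ·h = Σ_f σ(f)h(f)`. -/
def dot {k : ℕ} (σ h : Δ.Chain k) : ℤ := ∑ f, σ f * h f

/-- The `i`-th nonnegative kernel `ker⁺L_i`: effective `i`-chains in `ker L_i`. -/
def kerPlus (i : ℕ) : Set (Δ.Chain (i + 1)) :=
  {τ | Δ.Lap i τ = 0 ∧ Δ.Effective τ}

/-- Two `i`-chains are linearly equivalent if their difference lies in `im L_i`. -/
def LinEquiv (i : ℕ) (σ σ' : Δ.Chain (i + 1)) : Prop :=
  σ' - σ ∈ LinearMap.range (Δ.Lap i)

/-- An `i`-chain is winnable if it is linearly equivalent to an effective `i`-chain. -/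
def Winnable (i : ℕ) (σ : Δ.Chain (i + 1)) : Prop :=
  ∃ σ', Δ.Effective σ' ∧ Δ.LinEquiv i σ σ'

/-- The Hilbert basis of `ker⁺L_i`: its nonzero elements that are not the sum of two
nonzero elements of `ker⁺L_i`. -/
def hilbBasis (i : ℕ) : Set (Δ.Chain (i + 1)) :=
  {τ | τ ∈ Δ.kerPlus i ∧ τ ≠ 0 ∧
    ¬ ∃ a ∈ Δ.kerPlus i, ∃ b ∈ Δ.kerPlus i, a ≠ 0 ∧ b ≠ 0 ∧ τ = a + b}

/-- The cycles among the chains on faces of cardinality `k`: the kernel of the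
(reduced) boundary map `∂_{k-1}`.  For `k = 0` (the `(-1)`-chains, where the boundary
map is zero) every chain is a cycle. -/
noncomputable def cycles : (k : ℕ) → Submodule ℤ (Δ.Chain k)
  | 0 => ⊤
  | (k + 1) => LinearMap.ker (Δ.bdry k)

/-- The image of the `i`-th Laplacian, viewed inside the `i`-cycles. -/
noncomputable def critSub (i : ℕ) : Submodule ℤ ↥(Δ.cycles (i + 1)) :=
  Submodule.comap (Δ.cycles (i + 1)).subtype (LinearMap.range (Δ.Lap i))

/-- The `i`-th critical group `crit_i(Δ) = ker ∂_i / im L_i`. -/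
noncomputable abbrev Crit (i : ℕ) : Type :=
  ↥(Δ.cycles (i + 1)) ⧸ Δ.critSub i

/-- The image of the boundary map `∂_k`, viewed inside the cycles `cycles k`. -/
noncomputable def bdrySub (k : ℕ) : Submodule ℤ ↥(Δ.cycles k) :=
  Submodule.comap (Δ.cycles k).subtype (LinearMap.range (Δ.bdry k))

/-- The reduced homology group `H̃_{k-1}(Δ) = ker ∂_{k-1} / im ∂_k` (so the `i`-th
reduced homology group of `Δ` is `RedHomologyAt (i+1)`). -/
noncomputable abbrev RedHomologyAt (k : ℕ) : Type :=
  ↥(Δ.cycles k) ⧸ Δ.bdrySub k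

/-- The orthogonal complement `(ker L_i)^⊥` of `ker L_i` in the `i`-chains. -/
def kerPerp (i : ℕ) : Submodule ℤ (Δ.Chain (i + 1)) where
  carrier := {σ | ∀ τ ∈ LinearMap.ker (Δ.Lap i), Δ.dot σ τ = 0}
  add_mem' := by
    intro a b ha hb τ hτ
    have h : Δ.dot (a + b) τ = Δ.dot a τ + Δ.dot b τ := by
      simp [dot, Pi.add_apply, add_mul, Finset.sum_add_distrib]
    rw [h, ha τ hτ, hb τ hτ, add_zero]
  zero_mem' := by
    intro τ hτ
    simp [dot]
  smul_mem' := by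
    intro c a ha τ hτ
    have h : Δ.dot (c • a) τ = c * Δ.dot a τ := by
      simp [dot, Pi.smul_apply, Finset.mul_sum, mul_assoc]
    rw [h, ha τ hτ, mul_zero]

/-! ### Pseudomanifolds -/

/-- `Δ` is a pseudomanifold of dimension `d` (the facets are the faces of
cardinality `d+1`): it is pure, non-branching, and strongly connected. -/
def IsPseudomanifold (d : ℕ) : Prop :=
  (∀ f ∈ Δ.faces, ∃ g ∈ Δ.Faces (d + 1), f ⊆ g) ∧
  (∀ g ∈ Δ.Faces d, ((Δ.Faces (d + 1)).filter fun f => g ⊆ f).card ≤ 2) ∧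
  (∀ f ∈ Δ.Faces (d + 1), ∀ f' ∈ Δ.Faces (d + 1),
    Relation.ReflTransGen
      (fun a b => a ∈ Δ.Faces (d + 1) ∧ b ∈ Δ.Faces (d + 1) ∧ (a ∩ b).card = d) f f')

/-- The boundary `∂Δ` of a `d`-dimensional pseudomanifold: the `(d-1)`-faces contained
in exactly one facet. -/
def pmBoundary (d : ℕ) : Finset (Finset (Fin n)) :=
  (Δ.Faces d).filter fun g => ((Δ.Faces (d + 1)).filter fun f => g ⊆ f).card = 1

/-- A pseudomanifold orientation for a `d`-dimensional pseudomanifold: a top chain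
`γ` with all coefficients `±1` whose boundary is supported on `∂Δ`. -/
noncomputable def IsOrientation (d : ℕ) (γ : Δ.Chain (d + 1)) : Prop :=
  (∀ f, γ f = 1 ∨ γ f = -1) ∧
  (∀ g : {f // f ∈ Δ.Faces d},
    (g : Finset (Fin n)) ∉ Δ.pmBoundary d → Δ.bdry d γ g = 0)

/-- `γ_j` as a top-dimensional chain, for a vertex `j` of the `γ`-incidence graph:
the extra vertex `γ_0 = 0` is encoded by `none`, and the oriented facet `γ_f` by
`some f`. -/
noncomputable def gammaInd (D : ℕ) (γ : Δ.Chain (D + 1)) :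
    Option {f // f ∈ Δ.Faces (D + 1)} → Δ.Chain (D + 1)
  | none => 0
  | some f => Pi.single f (γ f)

/-- The edge of the `γ`-incidence graph corresponding to the `(D-1)`-dimensional face
`σ` goes from the vertex `a` to the vertex `b`: this means `∂ᵗ(σ) = γ_b - γ_a`. -/
noncomputable def edgeFromTo (D : ℕ) (γ : Δ.Chain (D + 1)) (σ : {f // f ∈ Δ.Faces D})
    (a b : Option {f // f ∈ Δ.Faces (D + 1)}) : Prop :=
  Δ.tbdry D (Pi.single σ 1) = Δ.gammaInd D γ b - Δ.gammaInd D γ a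

/-- `τ` is the incidence vector of a simple directed cycle of the `γ`-incidence graph
`Γ(Δ,γ)`: there is a closed directed walk with pairwise distinct vertices and pairwise
distinct edges whose edge labels sum to `τ`. -/
noncomputable def IsCycleVector (D : ℕ) (γ : Δ.Chain (D + 1)) (τ : Δ.Chain D) : Prop :=
  ∃ (k : ℕ) (hk : 0 < k) (v : Fin k → Option {f // f ∈ Δ.Faces (D + 1)})
    (e : Fin k → {f // f ∈ Δ.Faces D}),
    Function.Injective v ∧ Function.Injective e ∧
    (∀ t : Fin k, Δ.edgeFromTo D γ (e t) (v t) (v ⟨(t.1 + 1) % k, Nat.mod_lt _ hk⟩)) ∧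
    τ = ∑ t : Fin k, Pi.single (e t) (1 : ℤ)

/-! ### Spanning forests -/

/-- The chains supported on a set `F` of faces. -/
def suppIn (k : ℕ) (F : Finset (Finset (Fin n))) : Submodule ℤ (Δ.Chain k) where
  carrier := {σ | ∀ f : {f // f ∈ Δ.Faces k}, (f : Finset (Fin n)) ∉ F → σ f = 0}
  add_mem' := by
    intro a b ha hb f hf
    simp [Pi.add_apply, ha f hf, hb f hf]
  zero_mem' := by intro f hf; rfl
  smul_mem' := by
    intro c a ha f hf
    simp [Pi.smul_apply, ha f hf]

/-- The reduced homology group `H̃_{i-1}(Υ)` of the subcomplex `Υ` with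
`Skel_{i-1}(Υ) = Skel_{i-1}(Δ)` and with set of `i`-faces `F`: namely
`ker ∂_{i-1} / ∂_i(chains supported on F)`. -/
noncomputable abbrev forestHom (i : ℕ) (F : Finset (Finset (Fin n))) : Type :=
  ↥(Δ.cycles i) ⧸ Submodule.comap (Δ.cycles i).subtype
      (Submodule.map (Δ.bdry i) (Δ.suppIn (i + 1) F))

/-- `F ⊆ Δ_i` encodes a spanning `i`-forest of `Δ`: the `i`-dimensional subcomplex
`Υ` with `Skel_{i-1}(Υ) = Skel_{i-1}(Δ)` and with `i`-faces `F`, subject to: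
`H̃_i(Υ) = 0`; `β̃_{i-1}(Υ) = β̃_{i-1}(Δ)`; and `|Υ_i| = |Δ_i| - β̃_i(Skel_i(Δ))`
(note `H̃_i(Skel_i(Δ)) = ker ∂_i` since `Skel_i(Δ)` has no `(i+1)`-faces). -/
noncomputable def IsSpanningForest (i : ℕ) (F : Finset (Finset (Fin n))) : Prop :=
  F ⊆ Δ.Faces (i + 1) ∧
  (∀ σ ∈ Δ.suppIn (i + 1) F, Δ.bdry i σ = 0 → σ = 0) ∧
  Module.finrank ℤ (Δ.forestHom i F) = Module.finrank ℤ (Δ.RedHomologyAt i) ∧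
  F.card = (Δ.Faces (i + 1)).card - Module.finrank ℤ ↥(Δ.cycles (i + 1))

open scoped Classical in
/-- The `i`-forest number `τ_i(Δ) = Σ_Υ |T(H̃_{i-1}(Υ))|²`, the sum over all spanning
`i`-forests of `Δ`. -/
noncomputable def forestNumber (i : ℕ) : ℕ :=
  ∑ F ∈ (Δ.Faces (i + 1)).powerset.filter (fun F => Δ.IsSpanningForest i F),
    (Nat.card ↥(Submodule.torsion ℤ (Δ.forestHom i F))) ^ 2

/-- Restriction of chains to the coordinates indexed by a subset `Θ` of the faces
(i.e. setting the remaining coordinates to `0`). -/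
noncomputable def restrictTo (k : ℕ) (Θ : Finset (Finset (Fin n)))
    (hΘ : Θ ⊆ Δ.Faces k) : Δ.Chain k →ₗ[ℤ] ({f // f ∈ Θ} → ℤ) where
  toFun σ := fun a => σ ⟨a.1, hΘ a.2⟩
  map_add' := by intros; rfl
  map_smul' := by intros; rfl

/-- The reduced Laplacian: the square submatrix of `L_i` consisting of the rows
and columns indexed by `Θ`, as a linear map `ℤΘ → ℤΘ`. -/
noncomputable def redLap (i : ℕ) (Θ : Finset (Finset (Fin n)))
    (hΘ : Θ ⊆ Δ.Faces (i + 1)) : ({f // f ∈ Θ} → ℤ) →ₗ[ℤ] ({f // f ∈ Θ} → ℤ) :=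
  (Matrix.of fun a b : {f // f ∈ Θ} =>
    Δ.LapM i ⟨a.1, hΘ a.2⟩ ⟨b.1, hΘ b.2⟩).mulVecLin

end SComplex

namespace SComplex

variable {n : ℕ} (Δ : SComplex n)

theorem bcoef_erase {f : Finset (Fin n)} {v : Fin n} (hv : v ∈ f) :
    bcoef f (f.erase v) = (-1 : ℤ) ^ (f.filter (fun x => x < v)).card := by
  have h : f \ f.erase v = {v} := by
    ext x
    simp only [mem_sdiff, mem_erase, mem_singleton]
    grind
  rw [bcoef, if_pos ⟨erase_subset v f, (card_erase_add_one hv).symm⟩, h, sum_singleton]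

/-- The coboundary at a face `f`, as an alternating sum over the vertices of `f`. -/
theorem tbdry_apply (k : ℕ) (φ : Finset (Fin n) → ℤ) (f : {f // f ∈ Δ.Faces (k + 1)}) :
    Δ.tbdry k (fun g => φ g) f =
      ∑ v ∈ f.1, (-1 : ℤ) ^ (f.1.filter (fun x => x < v)).card * φ (f.1.erase v) := by
  obtain ⟨f, hf⟩ := f
  obtain ⟨hfΔ, hcard⟩ := mem_filter.1 hf
  have hsub : f.image f.erase ⊆ Δ.Faces k := by
    intro g hg
    obtain ⟨v, hv, rfl⟩ := mem_image.1 hg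
    refine mem_filter.2 ⟨Δ.down_closed f hfΔ _ (erase_subset v f), ?_⟩
    rw [card_erase_of_mem hv, hcard, Nat.add_sub_cancel]
  have hinj : Set.InjOn f.erase f := erase_injOn f
  have hzero : ∀ g ∈ Δ.Faces k, g ∉ f.image f.erase → bcoef f g * φ g = 0 := by
    intro g _ hg
    rw [bcoef, if_neg, zero_mul]
    rintro ⟨hgf, hc⟩
    obtain ⟨v, hv⟩ := card_eq_one.1
      (show (f \ g).card = 1 by rw [card_sdiff_of_subset hgf]; lia)
    refine hg (mem_image.2 ⟨v, ?_, ?_⟩)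
    · exact (mem_sdiff.1 (hv ▸ mem_singleton_self v)).1
    · rw [← sdiff_singleton_eq_erase, ← hv, Finset.sdiff_sdiff_eq_self hgf]
  calc Δ.tbdry k (fun g => φ g) ⟨f, hf⟩
      = ∑ g : {g // g ∈ Δ.Faces k}, bcoef f g * φ g := rfl
    _ = ∑ g ∈ Δ.Faces k, bcoef f g * φ g :=
        sum_coe_sort (Δ.Faces k) fun g => bcoef f g * φ g
    _ = ∑ g ∈ f.image f.erase, bcoef f g * φ g := (sum_subset hsub hzero).symm
    _ = ∑ v ∈ f, bcoef f (f.erase v) * φ (f.erase v) := sum_image hinj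
    _ = _ := sum_congr rfl fun v hv => by rw [bcoef_erase hv]

theorem Lap_eq_zero_of_tbdry_eq_zero {i : ℕ} {τ : Δ.Chain (i + 1)}
    (h : Δ.tbdry (i + 1) τ = 0) : Δ.Lap i τ = 0 := by
  rw [tbdry, mulVecLin_apply] at h
  rw [Lap, LapM, mulVecLin_apply, ← mulVec_mulVec, h, mulVec_zero]

end SComplex

section AlternatingSum

variable {α : Type*} [LinearOrder α]

/-- The sum over `f` of the values of `c`, with alternating signs in increasing order. -/
def Finset.altSum (f : Finset α) (c : α → ℤ) : ℤ :=
  ∑ v ∈ f, (-1 : ℤ) ^ (f.filter (fun x => x < v)).card * c v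

theorem Finset.altSum_insert {a : α} {f : Finset α} (h : ∀ x ∈ f, a < x) (c : α → ℤ) :
    (insert a f).altSum c = c a - f.altSum c := by
  have ha : a ∉ f := fun haf => (h a haf).false
  have h0 : (insert a f).filter (fun x => x < a) = ∅ := by
    refine filter_false_of_mem fun x hx => ?_
    rcases mem_insert.1 hx with rfl | hx
    · exact lt_irrefl _
    · exact (h x hx).not_gt
  rw [altSum, sum_insert ha, h0, altSum, card_empty, pow_zero, one_mul, sub_eq_add_neg,
    ← sum_neg_distrib]
  refine congrArg _ (sum_congr rfl fun v hv => ?_)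
  rw [filter_insert, if_pos (h v hv), card_insert_of_notMem (fun h' => ha (mem_filter.1 h').1)]
  ring

theorem Finset.altSum_one (f : Finset α) :
    f.altSum (fun _ => 1) = if Even f.card then 0 else 1 := by
  induction f using Finset.induction_on_min with
  | empty => simp [altSum]
  | insert a f h ih =>
    rw [altSum_insert h, ih, card_insert_of_notMem fun haf => (h a haf).false]
    simp only [Nat.even_add_one]
    split_ifs <;> rfl

theorem Finset.altSum_altSum_erase (f : Finset α) (c : α → ℤ) :
    f.altSum (fun v => (f.erase v).altSum c) = if Even f.card then -f.altSum c else 0 := by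
  induction f using Finset.induction_on_min with
  | empty => simp [altSum]
  | insert a f h ih =>
    have ha : a ∉ f := fun haf => (h a haf).false
    have herase : f.altSum (fun v => ((insert a f).erase v).altSum c) =
        c a * f.altSum (fun _ => 1) - f.altSum (fun v => (f.erase v).altSum c) := by
      rw [altSum, altSum, altSum, mul_sum, ← sum_sub_distrib]
      refine sum_congr rfl fun v hv => ?_
      rw [erase_insert_of_ne (h v hv).ne, altSum_insert fun x hx => h x (mem_of_mem_erase hx)]
      ring
    rw [altSum_insert h, erase_insert ha, herase, ih, altSum_one, altSum_insert h,
      card_insert_of_notMem ha]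
    simp only [Nat.even_add_one]
    split_ifs <;> ring

theorem Finset.altSum_bounds (f : Finset α) {c : α → ℤ} (hc : StrictMono c) :
    (Even f.card → f.Nonempty → f.altSum c < 0) ∧
      (¬ Even f.card → ∀ b, (∀ x ∈ f, b < x) → c b < f.altSum c) := by
  induction f using Finset.induction_on_min with
  | empty => simp
  | insert a f h ih =>
    rw [altSum_insert h, card_insert_of_notMem fun haf => (h a haf).false, Nat.even_add_one,
      not_not]
    refine ⟨fun hf _ => sub_neg.2 (ih.2 hf a h), fun hf b hb => ?_⟩
    have hba := hc (hb a (mem_insert_self a f))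
    rcases f.eq_empty_or_nonempty with rfl | hne
    · simpa [altSum] using hba
    · linarith [ih.1 hf hne]

end AlternatingSum

/-- For each `i`, there is a strictly positive element of `ker L_i`:
an `i`-chain `τ` with `L_i τ = 0` and `τ(f) > 0` for every `i`-face `f` of `Δ`. -/
theorem exists_strictly_positive_kernel_element {n : ℕ} (Δ : SComplex n) (i : ℕ) :
    ∃ τ : Δ.Chain (i + 1), Δ.Lap i τ = 0 ∧ ∀ f, 0 < τ f := by
  rcases Nat.even_or_odd i with hi | hi
  · refine ⟨fun _ => 1, Δ.Lap_eq_zero_of_tbdry_eq_zero (funext fun f => ?_), fun _ => one_pos⟩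
    have hcard : f.1.card = i + 1 + 1 := (mem_filter.1 f.2).2
    have hf := f.1.altSum_one
    rw [if_pos (by rw [hcard]; exact hi.add_one.add_one)] at hf
    exact (Δ.tbdry_apply (i + 1) (fun _ => 1) f).trans hf
  · have hc : StrictMono fun v : Fin n => (v : ℤ) := fun a b hab => by
      simpa using hab
    refine ⟨fun f => -f.1.altSum fun v => (v : ℤ),
      Δ.Lap_eq_zero_of_tbdry_eq_zero (funext fun f => ?_), fun f => ?_⟩
    · have hcard : f.1.card = i + 1 + 1 := (mem_filter.1 f.2).2
      have hf := f.1.altSum_altSum_erase fun v => (v : ℤ)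
      rw [if_neg (by rw [hcard]; exact Nat.not_even_iff_odd.2 hi.add_one.add_one)] at hf
      rw [Δ.tbdry_apply (i + 1) (fun g => -g.altSum fun v => (v : ℤ)) f]
      simp only [mul_neg, sum_neg_distrib]
      exact neg_eq_zero.2 hf
    · have hcard : f.1.card = i + 1 := (mem_filter.1 f.2).2
      exact neg_pos.2 ((f.1.altSum_bounds hc).1 (by rw [hcard]; exact hi.add_one)
        (card_pos.1 (by lia)))
end

section
/- For each integer i, one has im L_i ⊆ im ∂_{i+1}, the quotient im ∂_{i+1} / im L_i is finite, and hence the natural surjection crit_i(Δ) → H̃_i(Δ) has finite kernel; consequently it becomes an isomorphism after tensoring with ℚ (an isomorphism of free parts) and it restricts to a surjection T(crit_i(Δ)) → T(H̃_i(Δ)) on torsion subgroups. -/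
open Finset Matrix

/-- For an integer matrix `A`, every vector in the image of `A` has a nonzero multiple in the
image of `A * Aᵀ`. -/
theorem exists_smul_mulVec_eq_mul_transpose_mulVec {m n : Type*} [Fintype m] [Fintype n]
    (A : Matrix m n ℤ) (x : n → ℤ) :
    ∃ N : ℤ, N ≠ 0 ∧ ∃ y : m → ℤ, (A * Aᵀ).mulVec y = N • A.mulVec x := by
  classical
  set Q : Matrix m n ℚ := A.map (Int.cast : ℤ → ℚ)
  have hrange : LinearMap.range (Q * Qᵀ).mulVecLin = LinearMap.range Q.mulVecLin := by
    refine Submodule.eq_of_le_of_finrank_eq ?_ (Matrix.rank_self_mul_transpose Q)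
    rw [Matrix.mulVecLin_mul]
    exact LinearMap.range_comp_le_range _ _
  have hmem : Q.mulVecLin (fun j => (x j : ℚ)) ∈ LinearMap.range (Q * Qᵀ).mulVecLin :=
    hrange ▸ LinearMap.mem_range_self _ _
  obtain ⟨z, hz⟩ := hmem
  obtain ⟨b, hb⟩ := IsLocalization.exist_integer_multiples_of_finite (nonZeroDivisors ℤ) z
  choose y hy using hb
  refine ⟨b, nonZeroDivisors.coe_ne_zero b, y, ?_⟩
  have hy' : (fun j => (y j : ℚ)) = ((b : ℤ) : ℚ) • z := by
    funext j
    simpa using hy j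
  have hM : Q * Qᵀ = (A * Aᵀ).map (Int.castRingHom ℚ) := by
    rw [Matrix.map_mul]
    rfl
  have hcast : (Q * Qᵀ).mulVec (fun j => (y j : ℚ)) =
      ((b : ℤ) : ℚ) • Q.mulVec (fun j => (x j : ℚ)) := by
    rw [hy', Matrix.mulVec_smul]
    exact congrArg _ hz
  funext j
  have hj := congrFun hcast j
  rw [hM] at hj
  have h1 := RingHom.map_mulVec (Int.castRingHom ℚ) (A * Aᵀ) y j
  have h2 := RingHom.map_mulVec (Int.castRingHom ℚ) A x j
  have : (((A * Aᵀ).mulVec y j : ℤ) : ℚ) = ((b * A.mulVec x j : ℤ) : ℚ) := by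
    push_cast
    exact h1.trans (hj.trans (congrArg (fun t => ((b : ℤ) : ℚ) * t) h2.symm))
  exact_mod_cast this

open TensorProduct in
/-- Tensoring with `ℚ` kills torsion. -/
theorem subsingleton_rat_tensor_of_isTorsion {K : Type*} [AddCommGroup K]
    (hK : Module.IsTorsion ℤ K) : Subsingleton (ℚ ⊗[ℤ] K) := by
  refine subsingleton_of_forall_eq 0 fun t => ?_
  induction t with
  | zero => rfl
  | add a b ha hb => rw [ha, hb, add_zero]
  | tmul q k =>
    obtain ⟨a, ha⟩ := @hK k
    have ha' : (a : ℤ) • k = 0 := ha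
    have ha0 : ((a : ℤ) : ℚ) ≠ 0 := Int.cast_ne_zero.mpr (nonZeroDivisors.coe_ne_zero a)
    have hq : q = (a : ℤ) • (q / (a : ℤ)) := by
      rw [zsmul_eq_mul]
      field_simp
    rw [hq, TensorProduct.smul_tmul, ha', TensorProduct.tmul_zero]

/-- A surjection of abelian groups with torsion kernel becomes bijective after tensoring
with `ℚ`. -/
theorem bijective_lTensor_rat_of_isTorsion_ker {M N : Type*} [AddCommGroup M] [AddCommGroup N]
    (f : M →ₗ[ℤ] N) (hf : Function.Surjective f)
    (hK : Module.IsTorsion ℤ (LinearMap.ker f)) : Function.Bijective (LinearMap.lTensor ℚ f) := by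
  refine ⟨?_, LinearMap.lTensor_surjective ℚ hf⟩
  have := subsingleton_rat_tensor_of_isTorsion hK
  have hex := lTensor_exact ℚ f.exact_subtype_ker_map hf
  rw [injective_iff_map_eq_zero]
  intro t ht
  obtain ⟨s, rfl⟩ := (hex t).mp ht
  rw [Subsingleton.elim s 0, map_zero]

/-- A surjection of abelian groups with torsion kernel is surjective on torsion. -/
theorem exists_mem_torsion_of_isTorsion_ker {M N : Type*} [AddCommGroup M] [AddCommGroup N]
    (f : M →ₗ[ℤ] N) (hf : Function.Surjective f)
    (hK : Module.IsTorsion ℤ (LinearMap.ker f)) {y : N} (hy : y ∈ Submodule.torsion ℤ N) :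
    ∃ x ∈ Submodule.torsion ℤ M, f x = y := by
  obtain ⟨x, rfl⟩ := hf y
  obtain ⟨a, ha⟩ := (Submodule.mem_torsion_iff _).mp hy
  have hker : a • x ∈ LinearMap.ker f := by
    rw [LinearMap.mem_ker]
    exact (map_smul f (a : ℤ) x).trans ha
  obtain ⟨b, hb⟩ := @hK ⟨a • x, hker⟩
  refine ⟨x, (Submodule.mem_torsion_iff _).mpr ⟨b * a, ?_⟩, rfl⟩
  rw [mul_smul]
  exact congrArg Subtype.val hb

namespace SComplex

variable {n : ℕ} (Δ : SComplex n) (i : ℕ)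

theorem range_Lap_le_range_bdry :
    LinearMap.range (Δ.Lap i) ≤ LinearMap.range (Δ.bdry (i + 1)) := by
  rw [Lap, LapM, Matrix.mulVecLin_mul]
  exact LinearMap.range_comp_le_range _ _

theorem exists_smul_mem_range_Lap {z : Δ.Chain (i + 1)}
    (hz : z ∈ LinearMap.range (Δ.bdry (i + 1))) :
    ∃ a : nonZeroDivisors ℤ, a • z ∈ LinearMap.range (Δ.Lap i) := by
  obtain ⟨x, rfl⟩ := hz
  obtain ⟨N, hN, y, hy⟩ := exists_smul_mulVec_eq_mul_transpose_mulVec (Δ.B (i + 1)) x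
  exact ⟨⟨N, mem_nonZeroDivisors_of_ne_zero hN⟩, y, hy⟩

theorem finite_range_bdry_quotient :
    Finite (↥(LinearMap.range (Δ.bdry (i + 1))) ⧸
      Submodule.comap (LinearMap.range (Δ.bdry (i + 1))).subtype
        (LinearMap.range (Δ.Lap i))) := by
  refine Module.finite_of_fg_torsion _ fun {q} => ?_
  obtain ⟨⟨z, hz⟩, rfl⟩ := Submodule.Quotient.mk_surjective _ q
  obtain ⟨a, ha⟩ := Δ.exists_smul_mem_range_Lap i hz
  exact ⟨a, (Submodule.Quotient.mk_eq_zero _).mpr ha⟩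

theorem isTorsion_ker_mapQ
    (h : Δ.critSub i ≤ Submodule.comap LinearMap.id (Δ.bdrySub (i + 1))) :
    Module.IsTorsion ℤ (LinearMap.ker
      (Submodule.mapQ (Δ.critSub i) (Δ.bdrySub (i + 1)) LinearMap.id h)) := by
  rintro ⟨q, hq⟩
  obtain ⟨⟨z, hz⟩, rfl⟩ := Submodule.Quotient.mk_surjective _ q
  have hz' : z ∈ LinearMap.range (Δ.bdry (i + 1)) :=
    (Submodule.Quotient.mk_eq_zero (Δ.bdrySub (i + 1))).mp hq
  obtain ⟨a, ha⟩ := Δ.exists_smul_mem_range_Lap i hz'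
  exact ⟨a, Subtype.ext ((Submodule.Quotient.mk_eq_zero (Δ.critSub i)).mpr ha)⟩

end SComplex

/-- `im L_i ⊆ im ∂_{i+1}`, the quotient `im ∂_{i+1} / im L_i` is
finite, and the natural surjection `crit_i(Δ) → H̃_i(Δ)` is surjective with finite
kernel; consequently it becomes an isomorphism after tensoring with `ℚ` and restricts
to a surjection on torsion subgroups. -/
theorem crit_to_homology_surjection {n : ℕ} (Δ : SComplex n) (i : ℕ) :
    LinearMap.range (Δ.Lap i) ≤ LinearMap.range (Δ.bdry (i + 1)) ∧
    Finite (↥(LinearMap.range (Δ.bdry (i + 1))) ⧸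
      Submodule.comap (LinearMap.range (Δ.bdry (i + 1))).subtype
        (LinearMap.range (Δ.Lap i))) ∧
    ∀ (h : Δ.critSub i ≤ Submodule.comap LinearMap.id (Δ.bdrySub (i + 1))),
      Function.Surjective
          (Submodule.mapQ (Δ.critSub i) (Δ.bdrySub (i + 1)) LinearMap.id h) ∧
      Finite (LinearMap.ker
          (Submodule.mapQ (Δ.critSub i) (Δ.bdrySub (i + 1)) LinearMap.id h)) ∧
      Function.Bijective (LinearMap.lTensor ℚ
          (Submodule.mapQ (Δ.critSub i) (Δ.bdrySub (i + 1)) LinearMap.id h)) ∧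
      ∀ y ∈ Submodule.torsion ℤ (Δ.RedHomologyAt (i + 1)),
        ∃ x ∈ Submodule.torsion ℤ (Δ.Crit i),
          Submodule.mapQ (Δ.critSub i) (Δ.bdrySub (i + 1)) LinearMap.id h x = y := by
  refine ⟨Δ.range_Lap_le_range_bdry i, Δ.finite_range_bdry_quotient i, fun h => ?_⟩
  have hsurj : Function.Surjective
      (Submodule.mapQ (Δ.critSub i) (Δ.bdrySub (i + 1)) LinearMap.id h) := by
    intro q
    obtain ⟨z, rfl⟩ := Submodule.Quotient.mk_surjective _ q
    exact ⟨Submodule.Quotient.mk z, rfl⟩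
  have htors := Δ.isTorsion_ker_mapQ i h
  exact ⟨hsurj, Module.finite_of_fg_torsion _ htors,
    bijective_lTensor_rat_of_isTorsion_ker _ hsurj htors,
    fun _ hy => exists_mem_torsion_of_isTorsion_ker _ hsurj htors hy⟩
end

section
/- For each integer i, there exists a finite set 𝒫 of i-chains on Δ such that every i-chain σ with σ·h ≥ 0 for all h ∈ ker⁺L_i can be written as σ = ζ + τ + φ, where ζ is an i-chain with ζ·h = 0 for all h ∈ ker⁺L_i, τ is effective, and φ ∈ 𝒫. -/
open Finset Matrix

/-- **Farkas' lemma** over a linearly ordered field: a linear functional that is nonnegative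
wherever finitely many others are all nonnegative is a nonnegative combination of them. -/
theorem LinearMap.exists_eq_sum_smul_of_nonneg {K V κ : Type*} [Field K] [LinearOrder K]
    [IsStrictOrderedRing K] [AddCommGroup V] [Module K V] (s : Finset κ)
    (a : κ → V →ₗ[K] K) (b : V →ₗ[K] K)
    (hb : ∀ x, (∀ j ∈ s, 0 ≤ a j x) → 0 ≤ b x) :
    ∃ u : κ → K, (∀ j, 0 ≤ u j) ∧ b = ∑ j ∈ s, u j • a j := by
  classical
  induction s using Finset.induction_on generalizing a b with
  | empty =>
    refine ⟨0, fun _ => le_rfl, LinearMap.ext fun x => ?_⟩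
    have h₁ := hb x (by simp)
    have h₂ := hb (-x) (by simp)
    rw [map_neg] at h₂
    simpa using le_antisymm (neg_nonneg.mp h₂) h₁
  | insert m s hm ih =>
    have sum_update (u : κ → K) (v : K) :
        ∑ j ∈ s, Function.update u m v j • a j = ∑ j ∈ s, u j • a j :=
      Finset.sum_congr rfl fun j hj => by
        rw [Function.update_of_ne (ne_of_mem_of_not_mem hj hm)]
    by_cases hs : ∀ x, (∀ j ∈ s, 0 ≤ a j x) → 0 ≤ b x
    · obtain ⟨u, hu, rfl⟩ := ih a b hs
      refine ⟨Function.update u m 0, fun j => ?_, ?_⟩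
      · by_cases hj : j = m <;> simp [hj, hu]
      · rw [Finset.sum_insert hm, Function.update_self, zero_smul, zero_add, sum_update]
    push Not at hs
    obtain ⟨y, hy, hby⟩ := hs
    have hmy : a m y < 0 := by
      by_contra! h
      exact hby.not_ge (hb y fun j hj => by
        rcases Finset.mem_insert.mp hj with rfl | hj
        exacts [h, hy j hj])
    obtain ⟨u, hu, hbu⟩ := ih (fun j => a j - (a j y / a m y) • a m) (b - (b y / a m y) • a m) <| by
      intro x hx
      have key (c : V →ₗ[K] K) :
          (c - (c y / a m y) • a m) x = c (x - (a m x / a m y) • y) := by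
        simp only [LinearMap.sub_apply, LinearMap.smul_apply, map_sub, map_smul, smul_eq_mul]
        ring
      rw [key]
      refine hb _ fun j hj => ?_
      rcases Finset.mem_insert.mp hj with rfl | hj
      · simp [hmy.ne]
      · rw [← key]
        exact hx j hj
    refine ⟨Function.update u m (b y / a m y - ∑ j ∈ s, u j * (a j y / a m y)), fun j => ?_, ?_⟩
    · by_cases hj : j = m
      · subst hj
        rw [Function.update_self]
        have h₁ : ∑ i ∈ s, u i * (a i y / a j y) ≤ 0 := Finset.sum_nonpos fun i hi =>
          mul_nonpos_of_nonneg_of_nonpos (hu i) (div_nonpos_of_nonneg_of_nonpos (hy i hi) hmy.le)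
        have h₂ := div_pos_of_neg_of_neg hby hmy
        linarith
      · rw [Function.update_of_ne hj]
        exact hu j
    · rw [Finset.sum_insert hm, Function.update_self, sum_update]
      ext x
      have h := LinearMap.congr_fun hbu x
      simp only [LinearMap.sub_apply, LinearMap.add_apply, LinearMap.smul_apply,
        LinearMap.sum_apply, smul_eq_mul, mul_sub, Finset.sum_sub_distrib, ← mul_assoc,
        ← Finset.sum_mul] at h ⊢
      linear_combination h

/-- A rational vector on a finite index set has a positive integer multiple with integer entries. -/
theorem exists_pos_natCast_mul_eq_intCast {ι : Type*} [Fintype ι] (x : ι → ℚ) :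
    ∃ (N : ℕ) (h : ι → ℤ), 0 < N ∧ ∀ j, (h j : ℚ) = N * x j := by
  choose k hk using fun j => Finset.dvd_prod_of_mem (fun j => (x j).den) (Finset.mem_univ j)
  refine ⟨∏ j, (x j).den, fun j => k j * (x j).num, Finset.prod_pos fun j _ => (x j).den_pos,
    fun j => ?_⟩
  rw [hk j]
  push_cast
  rw [mul_comm ((x j).den : ℚ), mul_assoc, Rat.den_mul_eq_num]

/-- An integer vector that is nonnegative on the nonnegative integer kernel of an integer matrix
is a rational combination of the rows plus a nonnegative rational vector. -/
theorem Matrix.exists_rat_eq_vecMul_add_of_nonneg {ι κ : Type*} [Fintype ι] [Fintype κ]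
    (A : Matrix κ ι ℤ) (σ : ι → ℤ)
    (hσ : ∀ h : ι → ℤ, A *ᵥ h = 0 → (∀ j, 0 ≤ h j) → 0 ≤ ∑ j, σ j * h j) :
    ∃ (c : κ → ℚ) (t : ι → ℚ), (∀ j, 0 ≤ t j) ∧
      ∀ j, (σ j : ℚ) = ∑ g, c g * A g j + t j := by
  classical
  let row (g : κ) : (ι → ℚ) →ₗ[ℚ] ℚ := ∑ j, (A g j : ℚ) • LinearMap.proj j
  obtain ⟨u, hu, hσu⟩ := LinearMap.exists_eq_sum_smul_of_nonneg Finset.univ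
    (Sum.elim (fun j : ι => LinearMap.proj j) (Sum.elim row (-row)))
    (∑ j, (σ j : ℚ) • LinearMap.proj j) <| by
      intro x hx
      have hx₀ (j : ι) : 0 ≤ x j := hx (.inl j) (Finset.mem_univ _)
      have hrow (g : κ) : ∑ j, (A g j : ℚ) * x j = 0 := by
        have h₁ := hx (.inr (.inl g)) (Finset.mem_univ _)
        have h₂ := hx (.inr (.inr g)) (Finset.mem_univ _)
        simp [row] at h₁ h₂
        linarith
      obtain ⟨N, h, hN, hh⟩ := exists_pos_natCast_mul_eq_intCast x
      have hN' : (0 : ℚ) < N := by exact_mod_cast hN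
      have scale (v : ι → ℤ) : ((∑ j, v j * h j : ℤ) : ℚ) = N * ∑ j, (v j : ℚ) * x j := by
        push_cast
        rw [Finset.mul_sum]
        exact Finset.sum_congr rfl fun j _ => by rw [hh]; ring
      have hnonneg := hσ h
        (funext fun g => by
          have := scale (A g)
          rw [hrow, mul_zero] at this
          exact_mod_cast this)
        (fun j => by
          have : (0 : ℚ) ≤ h j := by rw [hh]; exact mul_nonneg hN'.le (hx₀ j)
          exact_mod_cast this)
      have : (0 : ℚ) ≤ N * ∑ j, (σ j : ℚ) * x j := by
        rw [← scale]
        exact_mod_cast hnonneg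
      simpa using nonneg_of_mul_nonneg_right this hN'
  refine ⟨fun g => u (.inr (.inl g)) - u (.inr (.inr g)), fun j => u (.inl j), fun j => hu _,
    fun j => ?_⟩
  have h := LinearMap.congr_fun hσu (Pi.single j 1)
  simp [row, Fintype.sum_sum_type, Pi.single_apply] at h
  rw [h]
  simp only [sub_mul, Finset.sum_sub_distrib]
  ring

/-- Up to a finite set of remainders, an integer vector that is nonnegative on the nonnegative
integer kernel of an integer matrix is an integer combination of the rows plus a nonnegative
integer vector. -/
theorem Matrix.exists_finset_eq_vecMul_add_add {ι κ : Type*} [Fintype ι] [Fintype κ]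
    (A : Matrix κ ι ℤ) :
    ∃ P : Finset (ι → ℤ), ∀ σ : ι → ℤ,
      (∀ h : ι → ℤ, A *ᵥ h = 0 → (∀ j, 0 ≤ h j) → 0 ≤ ∑ j, σ j * h j) →
        ∃ (d : κ → ℤ) (τ : ι → ℤ), (∀ j, 0 ≤ τ j) ∧ ∃ φ ∈ P, σ = d ᵥ* A + τ + φ := by
  classical
  let M (j : ι) : ℤ := ∑ g, |A g j| + 1
  refine ⟨Finset.Icc (-M) M, fun σ hσ => ?_⟩
  obtain ⟨c, t, ht, hct⟩ := A.exists_rat_eq_vecMul_add_of_nonneg σ hσ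
  refine ⟨fun g => ⌊c g⌋, fun j => ⌊t j⌋, fun j => Int.floor_nonneg.mpr (ht j),
    σ - (fun g => ⌊c g⌋) ᵥ* A - fun j => ⌊t j⌋, ?_, by abel⟩
  have bound (j : ι) : |(σ - (fun g => ⌊c g⌋) ᵥ* A - fun j => ⌊t j⌋) j| ≤ M j := by
    have hfract : (((σ - (fun g => ⌊c g⌋) ᵥ* A - fun j => ⌊t j⌋) j : ℤ) : ℚ)
        = ∑ g, Int.fract (c g) * A g j + Int.fract (t j) := by
      simp only [Pi.sub_apply, Matrix.vecMul, dotProduct, Int.fract, sub_mul,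
        Finset.sum_sub_distrib]
      push_cast
      rw [hct]
      ring
    have abs_fract (r : ℚ) : |Int.fract r| ≤ 1 := by
      rw [Int.abs_fract]
      exact (Int.fract_lt_one r).le
    have : |(((σ - (fun g => ⌊c g⌋) ᵥ* A - fun j => ⌊t j⌋) j : ℤ) : ℚ)| ≤ (M j : ℚ) := by
      rw [hfract]
      push_cast [M]
      refine (abs_add_le _ _).trans (add_le_add ((Finset.abs_sum_le_sum_abs _ _).trans
        (Finset.sum_le_sum fun g _ => ?_)) (abs_fract _))
      rw [abs_mul]
      exact mul_le_of_le_one_left (abs_nonneg _) (abs_fract _)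
    exact_mod_cast this
  exact Finset.mem_Icc.mpr ⟨fun j => (abs_le.mp (bound j)).1, fun j => (abs_le.mp (bound j)).2⟩

/-- There is a finite set `𝒫` of `i`-chains such that every `i`-chain
`σ` of nonnegative degree can be written `σ = ζ + τ + φ` with `ζ` of degree zero,
`τ` effective, and `φ ∈ 𝒫`. -/
theorem exists_finite_decomposition_set {n : ℕ} (Δ : SComplex n) (i : ℕ) :
    ∃ P : Finset (Δ.Chain (i + 1)),
      ∀ σ : Δ.Chain (i + 1), (∀ h ∈ Δ.kerPlus i, 0 ≤ Δ.dot σ h) →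
        ∃ ζ τ φ : Δ.Chain (i + 1),
          σ = ζ + τ + φ ∧ (∀ h ∈ Δ.kerPlus i, Δ.dot ζ h = 0) ∧
          Δ.Effective τ ∧ φ ∈ P := by
  obtain ⟨P, hP⟩ := (Δ.LapM i).exists_finset_eq_vecMul_add_add
  refine ⟨P, fun σ hσ => ?_⟩
  obtain ⟨d, τ, hτ, φ, hφ, h⟩ := hP σ fun h hker hnonneg => hσ h ⟨hker, hnonneg⟩
  refine ⟨d ᵥ* Δ.LapM i, τ, φ, h, fun x hx => ?_, hτ, hφ⟩
  change (d ᵥ* Δ.LapM i) ⬝ᵥ x = 0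
  have hx' : Δ.LapM i *ᵥ x = 0 := hx.1
  rw [← Matrix.dotProduct_mulVec, hx', dotProduct_zero]
end

section
/- For each integer i, there exists an i-chain ω on Δ such that every i-chain σ with σ·h ≥ ω·h for all h ∈ ker⁺L_i is winnable. In words: every i-chain of sufficiently large degree is winnable. -/
open Finset Matrix

/-- **Farkas' lemma** (affine form) over a linearly ordered field: a finite system of
inequalities `0 ≤ f j x + b j` is solvable unless a nonnegative combination of the
inequalities is contradictory. -/
theorem exists_forall_nonneg_or_exists_certificate {ι K W : Type*} [Field K] [LinearOrder K]
    [IsStrictOrderedRing K] [AddCommGroup W] [Module K W] (s : Finset ι)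
    (f : ι → W →ₗ[K] K) (b : ι → K) :
    (∃ x, ∀ j ∈ s, 0 ≤ f j x + b j) ∨
      ∃ c : ι → K, (∀ j, 0 ≤ c j) ∧ (∀ x, ∑ j ∈ s, c j * f j x = 0) ∧
        ∑ j ∈ s, c j * b j < 0 := by
  classical
  induction s using Finset.induction_on generalizing f b with
  | empty => exact Or.inl ⟨0, by simp⟩
  | insert a s ha ih =>
    have sum_update (c : ι → K) (t : K) (g : ι → K) :
        ∑ j ∈ s, Function.update c a t j * g j = ∑ j ∈ s, c j * g j :=
      Finset.sum_congr rfl fun j hj => by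
        rw [Function.update_of_ne (ne_of_mem_of_not_mem hj ha)]
    have update_nonneg {c : ι → K} {t : K} (hc : ∀ j, 0 ≤ c j) (ht : 0 ≤ t) (j : ι) :
        0 ≤ Function.update c a t j := by
      rcases eq_or_ne j a with rfl | hj
      · simpa using ht
      · simpa [hj] using hc j
    rcases ih f b with ⟨x₀, hx₀⟩ | ⟨c, hc, hcf, hcb⟩
    swap
    · exact Or.inr ⟨Function.update c a 0, update_nonneg hc le_rfl,
        fun x => by simp [Finset.sum_insert ha, sum_update, hcf],
        by simpa [Finset.sum_insert ha, sum_update] using hcb⟩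
    by_cases hax : 0 ≤ f a x₀ + b a
    · exact Or.inl ⟨x₀, by simpa [hax] using hx₀⟩
    push Not at hax
    by_cases hfa : f a = 0
    · refine Or.inr ⟨Function.update 0 a 1, update_nonneg (fun _ => le_rfl) zero_le_one,
        fun x => by simp [Finset.sum_insert ha, sum_update, hfa], ?_⟩
      simpa [Finset.sum_insert ha, sum_update, hfa] using hax
    obtain ⟨u, hu⟩ : ∃ u, f a u ≠ 0 := by
      by_contra! h
      exact hfa (LinearMap.ext h)
    obtain ⟨w, hw⟩ : ∃ w, f a w = 1 := ⟨(f a u)⁻¹ • u, by simp [hu]⟩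
    rcases ih (fun j => f j - f j w • f a) (fun j => b j - b a * f j w) with
      ⟨x, hx⟩ | ⟨c, hc, hcf, hcb⟩
    · refine Or.inl ⟨x - (f a x + b a) • w, ?_⟩
      intro j hj
      rcases Finset.mem_insert.mp hj with rfl | hj
      · simp [hw]
      · have := hx j hj
        simp only [LinearMap.sub_apply, LinearMap.smul_apply, smul_eq_mul, map_sub,
          map_smul] at this ⊢
        linarith
    · set t := ∑ j ∈ s, c j * f j w with ht
      have hcf' (x : W) : ∑ j ∈ s, c j * f j x = t * f a x := by
        have := hcf x
        simp only [LinearMap.sub_apply, LinearMap.smul_apply, smul_eq_mul, mul_sub,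
          Finset.sum_sub_distrib, ← mul_assoc, ← Finset.sum_mul] at this
        linarith
      have hcb' : ∑ j ∈ s, c j * b j - t * b a < 0 := by
        have : ∑ j ∈ s, c j * (b j - b a * f j w) = ∑ j ∈ s, c j * b j - t * b a := by
          simp only [mul_sub, Finset.sum_sub_distrib, ht, Finset.sum_mul]
          congr 1
          exact Finset.sum_congr rfl fun j _ => by ring
        linarith
      have hx₀' : 0 ≤ t * f a x₀ + ∑ j ∈ s, c j * b j := by
        rw [← hcf' x₀, ← Finset.sum_add_distrib]
        exact Finset.sum_nonneg fun j hj => by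
          rw [← mul_add]
          exact mul_nonneg (hc j) (hx₀ j hj)
      have ht_neg : t < 0 := by
        by_contra! h
        nlinarith [mul_nonneg h (neg_nonneg.mpr hax.le)]
      refine Or.inr ⟨Function.update c a (-t), update_nonneg hc (by linarith), fun x => ?_, ?_⟩
      · simp [Finset.sum_insert ha, sum_update, hcf']
      · simp only [Finset.sum_insert ha, sum_update, Function.update_self]
        linarith

/-- If an integer vector `b` pairs nonnegatively with all nonnegative integer vectors in the
left kernel of an integer matrix `M`, then `M x + b ≥ 0` has a rational solution. -/
theorem exists_rat_solution_of_forall_int_nonneg {ι κ : Type*} [Fintype ι] [Fintype κ]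
    (M : Matrix ι κ ℤ) (b : ι → ℤ)
    (h : ∀ c : ι → ℤ, (∀ j, 0 ≤ c j) → c ᵥ* M = 0 → 0 ≤ ∑ j, c j * b j) :
    ∃ x : κ → ℚ, ∀ j, 0 ≤ ∑ k, (M j k : ℚ) * x k + b j := by
  classical
  rcases exists_forall_nonneg_or_exists_certificate Finset.univ
    (fun j => (LinearMap.proj j).comp (M.map (Int.cast : ℤ → ℚ)).mulVecLin)
    (fun j => (b j : ℚ)) with ⟨x, hx⟩ | ⟨c, hc, hcM, hcb⟩
  · exact ⟨x, fun j => by simpa [Matrix.mulVec, dotProduct] using hx j (Finset.mem_univ j)⟩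
  exfalso
  obtain ⟨d, hd⟩ := IsLocalization.exist_integer_multiples_of_finite
    (Submonoid.pos ℤ) c
  choose z hz using hd
  have hdpos : (0 : ℚ) < ((d : ℤ) : ℚ) := Int.cast_pos.mpr d.2
  have hz' (j : ι) : (z j : ℚ) = (d : ℤ) * c j := by simpa using hz j
  have hzM : z ᵥ* M = 0 := by
    ext k
    have := hcM (Pi.single k 1)
    have key : ((∑ j, z j * M j k : ℤ) : ℚ) = 0 := by
      push_cast
      simp only [hz', mul_assoc, ← Finset.mul_sum]
      simpa using Or.inr this
    simpa [Matrix.vecMul, dotProduct] using Int.cast_eq_zero.mp key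
  have hz_nonneg (j : ι) : 0 ≤ z j := by
    rw [← Int.cast_nonneg_iff (R := ℚ), hz']
    exact mul_nonneg hdpos.le (hc j)
  have hzb : (0 : ℚ) ≤ ((∑ j, z j * b j : ℤ) : ℚ) := Int.cast_nonneg (h z hz_nonneg hzM)
  push_cast at hzb
  simp only [hz', mul_assoc, ← Finset.mul_sum] at hzb
  exact hcb.not_ge (nonneg_of_mul_nonneg_right hzb hdpos)

/-- There exists an `i`-chain `ω` such that every `i`-chain `σ` with
`σ·h ≥ ω·h` for all `h ∈ ker⁺L_i` is winnable: every `i`-chain of sufficiently large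
degree is winnable. -/
theorem large_degree_winnable {n : ℕ} (Δ : SComplex n) (i : ℕ) :
    ∃ ω : Δ.Chain (i + 1), ∀ σ : Δ.Chain (i + 1),
      (∀ h ∈ Δ.kerPlus i, Δ.dot ω h ≤ Δ.dot σ h) → Δ.Winnable i σ := by
  refine ⟨fun f => ∑ g, |Δ.LapM i f g|, fun σ hσ => ?_⟩
  have hsymm : (Δ.LapM i)ᵀ = Δ.LapM i := by simp [SComplex.LapM, Matrix.transpose_mul]
  obtain ⟨x, hx⟩ := exists_rat_solution_of_forall_int_nonneg (Δ.LapM i)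
    (fun f => σ f - ∑ g, |Δ.LapM i f g|) (fun c hc hcL => by
      have := hσ c ⟨by
        rw [SComplex.Lap, Matrix.mulVecLin_apply, ← hsymm, Matrix.mulVec_transpose, hcL], hc⟩
      simp only [SComplex.dot] at this
      simp only [mul_sub, Finset.sum_sub_distrib, sub_nonneg]
      simpa only [mul_comm] using this)
  refine ⟨σ + Δ.Lap i (fun g => ⌊x g⌋), fun f => ?_, ⟨fun g => ⌊x g⌋, by simp⟩⟩
  have hfract : ∑ g, (Δ.LapM i f g : ℚ) * Int.fract (x g) ≤ ∑ g, |(Δ.LapM i f g : ℚ)| :=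
    Finset.sum_le_sum fun g _ =>
      (mul_le_mul_of_nonneg_right (le_abs_self _) (Int.fract_nonneg _)).trans
        (mul_le_of_le_one_right (abs_nonneg _) (Int.fract_lt_one _).le)
  have hsplit : ∑ g, (Δ.LapM i f g : ℚ) * x g =
      ∑ g, (Δ.LapM i f g : ℚ) * ⌊x g⌋ + ∑ g, (Δ.LapM i f g : ℚ) * Int.fract (x g) := by
    simp_rw [← Finset.sum_add_distrib, ← mul_add, Int.floor_add_fract]
  have hxf := hx f
  push_cast at hxf
  have : (0 : ℚ) ≤ ((σ f + ∑ g, Δ.LapM i f g * ⌊x g⌋ : ℤ) : ℚ) := by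
    push_cast
    linarith
  simpa [SComplex.Lap, Matrix.mulVec, dotProduct] using Int.cast_nonneg_iff.mp this
end

section
/- Suppose every element of the Hilbert basis ℋ_i of ker⁺L_i has all coordinates in {0,1}. If σ is an i-chain with σ·h ≥ 0 for all h ∈ ker⁺L_i, then there exists an effective i-chain τ (not necessarily linearly equivalent to σ) with τ·h = σ·h for all h ∈ ker⁺L_i. -/
open Finset Matrix

/-- An induction principle for the nonnegative integer points of a lattice: every such
point is a sum of irreducible ones. -/
theorem nonneg_lattice_induction {ι : Type*} [Fintype ι] (K : AddSubgroup (ι → ℤ))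
    {P : (ι → ℤ) → Prop} (zero : P 0) (add : ∀ a b, P a → P b → P (a + b))
    (irred : ∀ h ∈ K, 0 ≤ h → h ≠ 0 →
      (¬ ∃ a b, (a ∈ K ∧ 0 ≤ a) ∧ (b ∈ K ∧ 0 ≤ b) ∧ a ≠ 0 ∧ b ≠ 0 ∧ h = a + b) → P h)
    {h : ι → ℤ} (hK : h ∈ K) (h_nonneg : 0 ≤ h) : P h := by
  have sum_pos : ∀ a : ι → ℤ, 0 ≤ a → a ≠ 0 → 0 < ∑ f, a f := fun a ha ha0 =>
    Fintype.sum_pos (lt_of_le_of_ne ha (Ne.symm ha0))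
  induction hN : (∑ f, h f).toNat using Nat.strong_induction_on generalizing h with
  | _ N ih =>
    by_cases h0 : h = 0
    · exact h0 ▸ zero
    by_cases hdec :
        ∃ a b, (a ∈ K ∧ 0 ≤ a) ∧ (b ∈ K ∧ 0 ≤ b) ∧ a ≠ 0 ∧ b ≠ 0 ∧ h = a + b
    · obtain ⟨a, b, ⟨haK, ha⟩, ⟨hbK, hb⟩, ha0, hb0, rfl⟩ := hdec
      have hsum : ∑ f, (a + b) f = ∑ f, a f + ∑ f, b f := Finset.sum_add_distrib
      have hapos := sum_pos a ha ha0
      have hbpos := sum_pos b hb hb0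
      exact add a b (ih _ (by omega) haK ha rfl) (ih _ (by omega) hbK hb rfl)
    · exact irred h hK h_nonneg h0 hdec

/-- A functional that is nonnegative on the nonnegative points of a lattice and vanishes
on one of maximal support vanishes on all of them. -/
theorem dotProduct_eq_zero_of_maximal_support {ι : Type*} [Fintype ι]
    (K : AddSubgroup (ι → ℤ)) {σ : ι → ℤ} (hσ : ∀ h ∈ K, 0 ≤ h → 0 ≤ σ ⬝ᵥ h)
    {s : ι → ℤ} (hsK : s ∈ K) (hs : 0 ≤ s)
    (hmax : ∀ h ∈ K, 0 ≤ h → ∀ f, 0 < h f → 0 < s f) (hσs : σ ⬝ᵥ s = 0)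
    {h : ι → ℤ} (hK : h ∈ K) (h_nonneg : 0 ≤ h) : σ ⬝ᵥ h = 0 := by
  set c : ℤ := ∑ f, h f
  have hle : ∀ f, h f ≤ c := fun f =>
    Finset.single_le_sum (fun g _ => h_nonneg g) (Finset.mem_univ f)
  have hdiff : 0 ≤ c • s - h := by
    intro f
    have hc : 0 ≤ c := Finset.sum_nonneg fun g _ => h_nonneg g
    have hsf : 0 ≤ s f := hs f
    have hhf : 0 ≤ h f := h_nonneg f
    simp only [Pi.zero_apply, Pi.sub_apply, Pi.smul_apply, smul_eq_mul]
    rcases hhf.eq_or_lt with h0 | hpos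
    · rw [← h0]
      nlinarith
    · nlinarith [hmax h hK h_nonneg f hpos, hle f]
  have hneg := hσ _ (K.sub_mem (K.zsmul_mem hsK c) hK) hdiff
  rw [dotProduct_sub, dotProduct_smul, hσs, smul_zero, zero_sub] at hneg
  exact le_antisymm (by linarith) (hσ h hK h_nonneg)

/-- If the irreducible nonnegative points of a lattice are `0`-`1` vectors, then every
integral functional that is nonnegative on the nonnegative points of the lattice agrees
there with one that has nonnegative coordinates. -/
theorem exists_nonneg_dotProduct_eq {ι : Type*} [Fintype ι] (K : AddSubgroup (ι → ℤ))
    (hirred : ∀ h ∈ K, 0 ≤ h → h ≠ 0 →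
      (¬ ∃ a b, (a ∈ K ∧ 0 ≤ a) ∧ (b ∈ K ∧ 0 ≤ b) ∧ a ≠ 0 ∧ b ≠ 0 ∧ h = a + b) →
      ∀ f, h f = 0 ∨ h f = 1)
    (σ : ι → ℤ) (hσ : ∀ h ∈ K, 0 ≤ h → 0 ≤ σ ⬝ᵥ h) :
    ∃ τ : ι → ℤ, 0 ≤ τ ∧ ∀ h ∈ K, 0 ≤ h → τ ⬝ᵥ h = σ ⬝ᵥ h := by
  classical
  -- Given a point of the lattice positive at each relevant coordinate, sum them all up.
  have exists_sum : ∀ Q : AddSubmonoid (ι → ℤ), (∀ h ∈ Q, h ∈ K ∧ 0 ≤ h) →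
      (∀ h ∈ K, 0 ≤ h → ∀ f, 0 < h f → ∃ g ∈ Q, 0 < g f) →
      ∃ s ∈ Q, ∀ h ∈ K, 0 ≤ h → ∀ f, 0 < h f → 0 < s f := by
    intro Q hQ hex
    have hch : ∀ f, ∃ g ∈ Q, ∀ h ∈ K, 0 ≤ h → 0 < h f → 0 < g f := by
      intro f
      by_cases hf : ∃ h ∈ K, 0 ≤ h ∧ 0 < h f
      · obtain ⟨h, hK, h0, hpos⟩ := hf
        obtain ⟨g, hg, hgf⟩ := hex h hK h0 f hpos
        exact ⟨g, hg, fun _ _ _ _ => hgf⟩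
      · exact ⟨0, Q.zero_mem, fun h hK h0 hpos => absurd ⟨h, hK, h0, hpos⟩ hf⟩
    choose g hgQ hg using hch
    refine ⟨∑ f, g f, Q.sum_mem fun f _ => hgQ f, fun h hK h0 f hpos => ?_⟩
    rw [Finset.sum_apply]
    exact (hg f h hK h0 hpos).trans_le
      (Finset.single_le_sum (f := fun e => g e f) (fun e _ => (hQ _ (hgQ e)).2 f)
        (Finset.mem_univ f))
  let N : AddSubmonoid (ι → ℤ) := K.toAddSubmonoid ⊓ AddSubmonoid.nonneg (ι → ℤ)
  obtain ⟨s, ⟨hsK, hs0 : 0 ≤ s⟩, hs⟩ := exists_sum N (fun h hh => hh)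
    (fun h hK h0 f hpos => ⟨h, ⟨hK, h0⟩, hpos⟩)
  induction hd : (σ ⬝ᵥ s).toNat using Nat.strong_induction_on generalizing σ with
  | _ d ih =>
    by_cases hz : ∀ h ∈ K, 0 ≤ h → ∀ f, 0 < h f →
        ∃ g, (g ∈ K ∧ 0 ≤ g) ∧ σ ⬝ᵥ g = 0 ∧ 0 < g f
    · let Z : AddSubmonoid (ι → ℤ) :=
        { carrier := {g | (g ∈ K ∧ 0 ≤ g) ∧ σ ⬝ᵥ g = 0}
          zero_mem' := ⟨⟨K.zero_mem, le_rfl⟩, dotProduct_zero σ⟩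
          add_mem' := fun {a b} ha hb =>
            ⟨⟨K.add_mem ha.1.1 hb.1.1, add_nonneg ha.1.2 hb.1.2⟩, by
              rw [dotProduct_add, ha.2, hb.2, add_zero]⟩ }
      obtain ⟨z, ⟨⟨hzK, hz0⟩, hσz⟩, hzmax⟩ := exists_sum Z (fun h hh => hh.1)
        (fun h hK h0 f hpos =>
          let ⟨g, hg, hσg, hgf⟩ := hz h hK h0 f hpos
          ⟨g, ⟨hg, hσg⟩, hgf⟩)
      refine ⟨0, le_rfl, fun h hK h0 => ?_⟩
      rw [zero_dotProduct,
        dotProduct_eq_zero_of_maximal_support K hσ hzK hz0 hzmax hσz hK h0]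
    · push Not at hz
      obtain ⟨h₁, hK₁, h₁0, f, hpos, hf⟩ := hz
      have hσ' : ∀ h ∈ K, 0 ≤ h → 0 ≤ (σ - Pi.single f 1) ⬝ᵥ h := by
        intro h hK h0
        refine nonneg_lattice_induction K (P := fun h => 0 ≤ (σ - Pi.single f 1) ⬝ᵥ h)
          (by simp) (fun a b ha hb => ?_) (fun g hgK hg0 hgne hg => ?_) hK h0
        · rw [dotProduct_add]
          exact add_nonneg ha hb
        · rw [sub_dotProduct, single_one_dotProduct]
          have hσg := hσ g hgK hg0
          rcases hirred g hgK hg0 hgne hg f with hgf | hgf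
          · omega
          · have hne : σ ⬝ᵥ g ≠ 0 := fun h => by
              have := hf g ⟨hgK, hg0⟩ h
              omega
            omega
      have hsf := hs h₁ hK₁ h₁0 f hpos
      have hσs := hσ' s hsK hs0
      have hdeg : (σ - Pi.single f 1) ⬝ᵥ s = σ ⬝ᵥ s - s f := by
        rw [sub_dotProduct, single_one_dotProduct]
      obtain ⟨τ, hτ, hτσ⟩ := ih _ (by omega) _ hσ' rfl
      refine ⟨τ + Pi.single f 1, add_nonneg hτ (Pi.single_nonneg.2 zero_le_one),
        fun h hK h0 => ?_⟩
      rw [add_dotProduct, hτσ h hK h0, sub_dotProduct, sub_add_cancel]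

/-- If every element of the Hilbert basis of `ker⁺L_i` has all
coordinates in `{0,1}`, then every `i`-chain `σ` of nonnegative degree has an
effective `i`-chain `τ` of the same degree. -/
theorem effective_chain_of_same_degree {n : ℕ} (Δ : SComplex n) (i : ℕ)
    (hhb : ∀ τ ∈ Δ.hilbBasis i, ∀ f, τ f = 0 ∨ τ f = 1)
    (σ : Δ.Chain (i + 1)) (hσ : ∀ h ∈ Δ.kerPlus i, 0 ≤ Δ.dot σ h) :
    ∃ τ : Δ.Chain (i + 1), Δ.Effective τ ∧ ∀ h ∈ Δ.kerPlus i, Δ.dot τ h = Δ.dot σ h := by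
  obtain ⟨τ, hτ, hτσ⟩ := exists_nonneg_dotProduct_eq
    (LinearMap.ker (Δ.Lap i)).toAddSubgroup
    (fun h hK h0 hne hirr => hhb h ⟨⟨hK, h0⟩, hne, fun ⟨a, ha, b, hb, hab⟩ =>
      hirr ⟨a, b, ha, hb, hab⟩⟩)
    σ (fun h hK h0 => hσ h ⟨hK, h0⟩)
  exact ⟨τ, hτ, fun h hh => hτσ h hh.1 hh.2⟩
end

section
/- Suppose every element of the Hilbert basis ℋ_i of ker⁺L_i has all coordinates in {0,1}, and suppose there exists an i-chain ω such that every i-chain σ with σ·h = ω·h for all h ∈ ker⁺L_i is winnable. Then every i-chain σ with σ·h ≥ ω·h for all h ∈ ker⁺L_i is winnable. -/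
open Finset Matrix

section NonnegPart

variable {ι : Type*}

/-- The effective vectors of a lattice `N`. -/
def nonnegPart (N : Submodule ℤ (ι → ℤ)) : Set (ι → ℤ) :=
  {τ | τ ∈ N ∧ 0 ≤ τ}

/-- The nonzero effective vectors of `N` that are not sums of two nonzero effective vectors. -/
def indecomposables (N : Submodule ℤ (ι → ℤ)) : Set (ι → ℤ) :=
  {τ | τ ∈ nonnegPart N ∧ τ ≠ 0 ∧
    ¬ ∃ a ∈ nonnegPart N, ∃ b ∈ nonnegPart N, a ≠ 0 ∧ b ≠ 0 ∧ τ = a + b}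

variable [Fintype ι]

theorem sum_pos_of_nonneg_of_ne_zero {τ : ι → ℤ} (h : 0 ≤ τ) (h0 : τ ≠ 0) : 0 < ∑ f, τ f := by
  obtain ⟨f, hf⟩ := Function.ne_iff.mp h0
  exact Finset.sum_pos' (fun g _ => h g) ⟨f, Finset.mem_univ f, lt_of_le_of_ne (h f) hf.symm⟩

/-- Some effective vector of `N` is positive wherever any effective vector of `N` is. -/
theorem exists_maximal_support (N : Submodule ℤ (ι → ℤ)) :
    ∃ z ∈ nonnegPart N, ∀ h ∈ nonnegPart N, ∀ f, 0 < h f → 0 < z f := by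
  classical
  have key : ∀ f, ∃ z ∈ nonnegPart N, ∀ h ∈ nonnegPart N, 0 < h f → 0 < z f := by
    intro f
    by_cases hf : ∃ h ∈ nonnegPart N, 0 < h f
    · obtain ⟨h, hN, hpos⟩ := hf
      exact ⟨h, hN, fun _ _ _ => hpos⟩
    · exact ⟨0, ⟨N.zero_mem, le_rfl⟩, fun h hN hpos => (hf ⟨h, hN, hpos⟩).elim⟩
  choose z hz hzpos using key
  refine ⟨∑ f, z f, ⟨N.sum_mem fun f _ => (hz f).1, Finset.sum_nonneg fun f _ => (hz f).2⟩, ?_⟩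
  intro h hN f hpos
  rw [Finset.sum_apply]
  exact Finset.sum_pos' (fun g _ => (hz g).2 f) ⟨f, Finset.mem_univ f, hzpos f h hN hpos⟩

/-- A linear functional that is nonnegative on the indecomposable effective vectors is
nonnegative on all effective vectors. -/
theorem dotProduct_nonneg_of_indecomposables {N : Submodule ℤ (ι → ℤ)} {d : ι → ℤ}
    (hd : ∀ τ ∈ indecomposables N, 0 ≤ d ⬝ᵥ τ) : ∀ τ ∈ nonnegPart N, 0 ≤ d ⬝ᵥ τ := by
  intro τ hτ
  induction hm : (∑ f, τ f).toNat using Nat.strong_induction_on generalizing τ with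
  | _ m ih =>
    by_cases h0 : τ = 0
    · simp [h0]
    by_cases hdec : ∃ a ∈ nonnegPart N, ∃ b ∈ nonnegPart N, a ≠ 0 ∧ b ≠ 0 ∧ τ = a + b
    · obtain ⟨a, ha, b, hb, ha0, hb0, rfl⟩ := hdec
      have hsa := sum_pos_of_nonneg_of_ne_zero ha.2 ha0
      have hsb := sum_pos_of_nonneg_of_ne_zero hb.2 hb0
      simp only [Pi.add_apply, Finset.sum_add_distrib] at hm
      rw [dotProduct_add]
      exact add_nonneg (ih _ (by omega) a ha rfl) (ih _ (by omega) b hb rfl)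
    · exact hd τ ⟨hτ, h0, hdec⟩

/-- If the effective vectors on which `d` vanishes have the same joint support as all
effective vectors, then `d`, being nonnegative on them, vanishes on all of them. -/
theorem dotProduct_eq_zero_of_support {N : Submodule ℤ (ι → ℤ)} {d : ι → ℤ}
    (hd : ∀ τ ∈ nonnegPart N, 0 ≤ d ⬝ᵥ τ) {z : ι → ℤ} (hz : z ∈ nonnegPart N)
    (hdz : d ⬝ᵥ z = 0) (hpos : ∀ h ∈ nonnegPart N, ∀ f, 0 < h f → 0 < z f) :
    ∀ h ∈ nonnegPart N, d ⬝ᵥ h = 0 := by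
  intro h hh
  have hmem : (∑ f, h f) • z - h ∈ nonnegPart N := by
    refine ⟨N.sub_mem (N.smul_mem _ hz.1) hh.1, fun f => ?_⟩
    have hle : h f ≤ ∑ g, h g := Finset.single_le_sum (fun g _ => hh.2 g) (Finset.mem_univ f)
    have hhf : 0 ≤ h f := hh.2 f
    have hzf : 0 ≤ z f := hz.2 f
    simp only [Pi.zero_apply, Pi.sub_apply, Pi.smul_apply, smul_eq_mul]
    rcases hhf.eq_or_lt with h0 | h0
    · have := mul_nonneg (hhf.trans hle) hzf
      omega
    · nlinarith [hpos h hh f h0]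
  have h1 := hd _ hmem
  rw [dotProduct_sub, dotProduct_smul, hdz, smul_zero] at h1
  linarith [hd h hh]

/-- If the indecomposable effective vectors of `N` are `0/1`-vectors, then every integral
functional that is nonnegative on the effective vectors of `N` agrees there with an
effective one. -/
theorem exists_effective_dotProduct_eq {N : Submodule ℤ (ι → ℤ)}
    (hN : ∀ τ ∈ indecomposables N, ∀ f, τ f = 0 ∨ τ f = 1) (d : ι → ℤ)
    (hd : ∀ τ ∈ nonnegPart N, 0 ≤ d ⬝ᵥ τ) :
    ∃ ε : ι → ℤ, 0 ≤ ε ∧ ∀ τ ∈ nonnegPart N, ε ⬝ᵥ τ = d ⬝ᵥ τ := by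
  classical
  obtain ⟨t, ht, htpos⟩ := exists_maximal_support N
  induction hm : (d ⬝ᵥ t).toNat using Nat.strong_induction_on generalizing d with
  | _ m ih =>
    obtain ⟨z, hz, hzpos⟩ :=
      exists_maximal_support (N ⊓ LinearMap.ker (dotProductBilin ℤ ℤ d))
    have hz' : z ∈ nonnegPart N := ⟨hz.1.1, hz.2⟩
    have hdz : d ⬝ᵥ z = 0 := hz.1.2
    by_cases hf : ∃ f, 0 < t f ∧ z f ≤ 0
    · obtain ⟨f, htf, hzf⟩ := hf
      have hd' : ∀ τ ∈ nonnegPart N, 0 ≤ (d - Pi.single f 1) ⬝ᵥ τ := by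
        refine dotProduct_nonneg_of_indecomposables fun τ hτ => ?_
        rw [sub_dotProduct, single_one_dotProduct]
        have h0 := hd τ hτ.1
        rcases hN τ hτ f with h1 | h1
        · omega
        · have : d ⬝ᵥ τ ≠ 0 := fun hzero =>
            absurd (hzpos τ ⟨⟨hτ.1.1, hzero⟩, hτ.1.2⟩ f (by omega)) (by omega)
          omega
      have hlt := hd' t ht
      obtain ⟨ε, hε, hεd⟩ := ih _ (by
        rw [sub_dotProduct, single_one_dotProduct] at hlt ⊢
        omega) (d - Pi.single f 1) hd' rfl
      refine ⟨ε + Pi.single f 1, add_nonneg hε (Pi.single_nonneg.mpr zero_le_one), ?_⟩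
      intro τ hτ
      rw [add_dotProduct, hεd τ hτ, sub_dotProduct, sub_add_cancel]
    · push Not at hf
      refine ⟨0, le_rfl, fun τ hτ => ?_⟩
      rw [zero_dotProduct, dotProduct_eq_zero_of_support hd hz' hdz
        (fun h hh f hhf => hf f (htpos h hh f hhf)) τ hτ]

end NonnegPart

theorem SComplex.Winnable.add_effective {n : ℕ} {Δ : SComplex n} {i : ℕ}
    {σ ε : Δ.Chain (i + 1)} (hσ : Δ.Winnable i σ) (hε : Δ.Effective ε) :
    Δ.Winnable i (σ + ε) := by
  obtain ⟨σ', hσ', heq⟩ := hσ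
  refine ⟨σ' + ε, fun f => add_nonneg (hσ' f) (hε f), ?_⟩
  rwa [SComplex.LinEquiv, add_sub_add_right_eq_sub]

/-- Suppose every element of the Hilbert basis of `ker⁺L_i` has all
coordinates in `{0,1}`, and that there is an `i`-chain `ω` such that every `i`-chain
of degree equal to that of `ω` is winnable.  Then every `i`-chain of degree at least
that of `ω` is winnable. -/
theorem winnable_above_degree {n : ℕ} (Δ : SComplex n) (i : ℕ)
    (hhb : ∀ τ ∈ Δ.hilbBasis i, ∀ f, τ f = 0 ∨ τ f = 1)
    (ω : Δ.Chain (i + 1))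
    (hω : ∀ σ : Δ.Chain (i + 1),
      (∀ h ∈ Δ.kerPlus i, Δ.dot σ h = Δ.dot ω h) → Δ.Winnable i σ) :
    ∀ σ : Δ.Chain (i + 1),
      (∀ h ∈ Δ.kerPlus i, Δ.dot ω h ≤ Δ.dot σ h) → Δ.Winnable i σ := by
  intro σ hσ
  obtain ⟨ε, hε, hεd⟩ := exists_effective_dotProduct_eq (N := LinearMap.ker (Δ.Lap i)) hhb
    (σ - ω) fun h hh => by
      rw [sub_dotProduct]
      exact sub_nonneg.mpr (hσ h hh)
  have hwin : Δ.Winnable i (σ - ε) := hω _ fun h hh => by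
    have h1 := hεd h hh
    rw [sub_dotProduct] at h1
    change (σ - ε) ⬝ᵥ h = ω ⬝ᵥ h
    rw [sub_dotProduct, h1, sub_sub_cancel]
  simpa using hwin.add_effective hε
end
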